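/- arXiv:1706.09949 — 2 statements merged into one kernel-verified Lean document; each statement's English description precedes it below -/
import Mathlib

section
/- There exists a universal constant c > 0 such that the following holds for every integer d ≥ 2. Consider an arrangement of 2d objects into three stacks of capacity d in which stacks 1 and 2 are full and stack 3 is empty, and let σ be any prescribed linear ordering of the objects of stack 1. Then there is a sequence of at most c · d · log d permissible pop-and-push actions after which stack 1 contains exactly its original objects arranged in the order σ from top to bottom, stack 2 contains exactly its original set of objects, and stack 3 is empty. -/
/-- An arrangement of `n` objects into `k` stacks of capacity `d`.
Depths are 0-based: Fin index `j` corresponds to depth `j+1`; index `0` is the top,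
index `d-1` is the bottom (depth `d`). The occupied depths of every stack form a
contiguous block containing the bottom. -/
structure Arrangement (n k d : ℕ) where
  pos : Fin n → Fin k × Fin d
  inj : Function.Injective pos
  contig : ∀ o : Fin n, ∀ j : Fin d, (pos o).2 ≤ j → ∃ o', pos o' = ((pos o).1, j)

/-- A permissible pop-and-push action: the top (minimal-depth) object `o` of a nonempty
stack is removed and pushed onto a different stack; all other objects stay put.
(Validity of the resulting `Arrangement` forces `o` to land on top of a stack that had
fewer than `d` objects.) -/
def Step {n k d : ℕ} (π π' : Arrangement n k d) : Prop :=
  ∃ o : Fin n,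
    (π'.pos o).1 ≠ (π.pos o).1 ∧
    (∀ o' : Fin n, o' ≠ o → (π.pos o').1 = (π.pos o).1 → (π.pos o).2 < (π.pos o').2) ∧
    (∀ o' : Fin n, o' ≠ o → π'.pos o' = π.pos o')

/-- `Reach π π' m`: the arrangement `π'` can be obtained from `π` by a sequence of
exactly `m` permissible pop-and-push actions. -/
def Reach {n k d : ℕ} (π π' : Arrangement n k d) (m : ℕ) : Prop :=
  ∃ f : ℕ → Arrangement n k d, f 0 = π ∧ f m = π' ∧ ∀ t, t < m → Step (f t) (f (t + 1))

/-- Stacks as lists, top first: the head of `S i` is popped and pushed onto `S j`. -/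
def ListMove {α : Type*} {k : ℕ} (d : ℕ) (S T : Fin k → List α) : Prop :=
  ∃ i j x, i ≠ j ∧ S i = x :: T i ∧ T j = x :: S j ∧ (S j).length < d ∧
    ∀ l, l ≠ i → l ≠ j → T l = S l

/-- `T` can be obtained from `S` by exactly `m` moves. -/
inductive ListReach {α : Type*} {k : ℕ} (d : ℕ) :
    ℕ → (Fin k → List α) → (Fin k → List α) → Prop
  | refl (S) : ListReach d 0 S S
  | head {m S T U} (h : ListMove d S T) (h' : ListReach d m T U) : ListReach d (m + 1) S U

namespace ListReach

variable {α : Type*} {k d : ℕ}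

theorem trans {S T U : Fin k → List α} {m n : ℕ} (h : ListReach d m S T)
    (h' : ListReach d n T U) : ListReach d (m + n) S U := by
  induction h with
  | refl => simpa using h'
  | head hm _ ih =>
    rw [Nat.add_right_comm]
    exact .head hm (ih h')

/-- Moving a block of objects from one stack to another reverses it. -/
theorem transfer {i j : Fin k} (hij : i ≠ j) (a : List α) {S T : Fin k → List α}
    (hi : S i = a ++ T i) (hj : T j = a.reverse ++ S j) (hT : ∀ l, l ≠ i → l ≠ j → T l = S l)
    (hd : a.length + (S j).length ≤ d) : ListReach d a.length S T := by
  induction a generalizing S with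
  | nil =>
    have : S = T := by
      ext1 l
      by_cases h₁ : l = i
      · subst h₁; simpa using hi
      by_cases h₂ : l = j
      · subst h₂; simpa using hj.symm
      exact (hT l h₁ h₂).symm
    subst this
    exact .refl S
  | cons x a ih =>
    simp only [List.length_cons] at hd
    refine .head (T := Function.update (Function.update S i (a ++ T i)) j (x :: S j))
      ⟨i, j, x, hij, ?_, ?_, by omega, ?_⟩ (ih ?_ ?_ ?_ ?_)
    · simp [hij, hi]
    · simp
    · intro l h₁ h₂
      simp [h₁, h₂]
    · simp [hij]
    · simp [hj]
    · intro l h₁ h₂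
      simp [h₁, h₂, hT]
    · simp
      omega

/-- Popping a block from stack `0` and distributing it over the other two stacks. -/
theorem distribute (p : α → Bool) (a a' b c : List α)
    (hb : (a.filter p).length + b.length ≤ d)
    (hc : (a.filter fun x => !p x).length + c.length ≤ d) :
    ListReach d a.length ![a ++ a', b, c]
      ![a', (a.filter p).reverse ++ b, (a.filter fun x => !p x).reverse ++ c] := by
  induction a generalizing b c with
  | nil => exact .refl _
  | cons x a ih =>
    cases hx : p x with
    | true =>
      simp only [List.filter_cons, hx, if_true, List.length_cons, Bool.not_true,
        Bool.false_eq_true, if_false, List.reverse_cons, List.append_assoc,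
        List.singleton_append] at hb hc ⊢
      refine .head (T := ![a ++ a', x :: b, c])
        ⟨0, 1, x, by decide, rfl, rfl, ?_, ?_⟩ (ih _ _ ?_ hc)
      · simp; omega
      · simp [Fin.forall_fin_succ]
      · simp; omega
    | false =>
      simp only [List.filter_cons, hx, if_true, List.length_cons, Bool.not_false,
        Bool.false_eq_true, if_false, List.reverse_cons, List.append_assoc,
        List.singleton_append] at hb hc ⊢
      refine .head (T := ![a ++ a', b, x :: c])
        ⟨0, 2, x, by decide, rfl, rfl, ?_, ?_⟩ (ih _ _ hb ?_)
      · simp; omega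
      · simp [Fin.forall_fin_succ]
      · simp; omega

/-- Stably partitioning the top block of stack `0`, using as much free room in stack `2` as
the block is long. -/
theorem partition (p : α → Bool) (a a' b c : List α) (ha : (a ++ a').length ≤ d)
    (hab : a.length ≤ b.length) (hb : b.length ≤ d) (hc : a.length + c.length ≤ d) :
    ListReach d (2 * a.length + 2 * (a.filter p).length) ![a ++ a', b, c]
      ![a.filter p ++ (a.filter (fun x => !p x) ++ a'), b, c] := by
  set lo := a.filter p with hlo
  set hi := a.filter (fun x => !p x) with hhi
  have hlen : a.length = lo.length + hi.length := List.length_eq_length_filter_add p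
  obtain ⟨b₁, b₂, rfl, hb₁⟩ : ∃ b₁ b₂, b = b₁ ++ b₂ ∧ b₁.length = lo.length :=
    ⟨b.take lo.length, b.drop lo.length, by simp, by simp; omega⟩
  simp only [List.length_append] at ha hab hb
  have h₁ : ListReach d b₁.length ![a ++ a', b₁ ++ b₂, c] ![a ++ a', b₂, b₁.reverse ++ c] :=
    transfer (i := 1) (j := 2) (by decide) b₁ rfl rfl (by simp [Fin.forall_fin_succ])
      (by simp; omega)
  have h₂ := distribute (d := d) p a a' b₂ (b₁.reverse ++ c) (by rw [← hlo]; omega)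
    (by rw [← hhi]; simp; omega)
  have h₃ : ListReach d hi.reverse.length ![a', lo.reverse ++ b₂, hi.reverse ++ (b₁.reverse ++ c)]
      ![hi ++ a', lo.reverse ++ b₂, b₁.reverse ++ c] :=
    transfer (i := 2) (j := 0) (by decide) hi.reverse rfl (by simp)
      (by simp [Fin.forall_fin_succ]) (by simp; omega)
  have h₄ : ListReach d lo.reverse.length ![hi ++ a', lo.reverse ++ b₂, b₁.reverse ++ c]
      ![lo ++ (hi ++ a'), b₂, b₁.reverse ++ c] :=
    transfer (i := 1) (j := 0) (by decide) lo.reverse rfl (by simp)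
      (by simp [Fin.forall_fin_succ]) (by simp; omega)
  have h₅ : ListReach d b₁.reverse.length ![lo ++ (hi ++ a'), b₂, b₁.reverse ++ c]
      ![lo ++ (hi ++ a'), b₁ ++ b₂, c] :=
    transfer (i := 2) (j := 1) (by decide) b₁.reverse rfl (by simp)
      (by simp [Fin.forall_fin_succ]) (by simp; omega)
  convert (((h₁.trans h₂).trans h₃).trans h₄).trans h₅ using 1
  simp
  omega

/-- Any permutation of the top block of stack `0` can be realised in `O(n log n)` moves. -/
theorem permute [DecidableEq α] (s a a' b c : List α) (hs : s.Perm a) (hnd : s.Nodup)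
    (ha : (a ++ a').length ≤ d) (hab : a.length ≤ b.length) (hb : b.length ≤ d)
    (hc : a.length + c.length ≤ d) :
    ∃ m ≤ 4 * a.length * Nat.clog 2 a.length, ListReach d m ![a ++ a', b, c] ![s ++ a', b, c] := by
  induction hn : a.length using Nat.strong_induction_on generalizing s a a' c with
  | _ n ih =>
  rcases Nat.lt_or_ge n 2 with hn2 | hn2
  · have : s = a := by
      match a, hn with
      | [], _ => simpa using hs
      | [x], _ => simpa using hs
      | x :: y :: l, h => simp at h; omega
    subst this
    exact ⟨0, Nat.zero_le _, .refl _⟩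
  have hsn : s.length = n := hs.length_eq.trans hn
  set k := n / 2 with hk
  set p : α → Bool := fun x => decide (x ∈ s.take k) with hp
  have hsplit : (s.take k ++ s.drop k).Nodup := by simpa using hnd
  have hdisj := List.disjoint_of_nodup_append hsplit
  have hlo : (s.take k).Perm (a.filter p) := by
    refine List.Perm.trans (.of_eq ?_) (hs.filter p)
    conv_rhs => rw [← List.take_append_drop k s, List.filter_append]
    rw [List.filter_eq_self.2 (by simp [hp]), List.filter_eq_nil_iff.2, List.append_nil]
    intro x hx
    simpa [hp] using fun h => hdisj h hx
  have hhi : (s.drop k).Perm (a.filter fun x => !p x) := by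
    refine List.Perm.trans (.of_eq ?_) (hs.filter _)
    conv_rhs => rw [← List.take_append_drop k s, List.filter_append]
    rw [List.filter_eq_nil_iff.2 (by simp [hp]), List.filter_eq_self.2, List.nil_append]
    intro x hx
    simpa [hp] using fun h => hdisj h hx
  have hpart := partition p a a' b c ha hab hb hc
  set lo := a.filter p
  set hi := a.filter (fun x => !p x)
  have hlol : lo.length = k := by rw [← hlo.length_eq]; simp; omega
  have hhil : hi.length = n - k := by rw [← hhi.length_eq]; simp; omega
  have hstl : (s.take k).length = k := hlo.length_eq.trans hlol
  simp only [List.length_append] at ha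
  obtain ⟨m₁, hm₁, h₁⟩ := ih k (by omega) (s.take k) lo (hi ++ a') c hlo hsplit.of_append_left
    (by simp; omega) (by omega) (by omega) hlol
  have h₂ : ListReach d (s.take k).length ![s.take k ++ (hi ++ a'), b, c]
      ![hi ++ a', b, (s.take k).reverse ++ c] :=
    transfer (i := 0) (j := 2) (by decide) _ rfl rfl (by simp [Fin.forall_fin_succ])
      (by simp; omega)
  obtain ⟨m₃, hm₃, h₃⟩ := ih (n - k) (by omega) (s.drop k) hi a' ((s.take k).reverse ++ c) hhi
    hsplit.of_append_right (by simp; omega) (by omega) (by simp; omega) hhil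
  have h₄ : ListReach d (s.take k).reverse.length
      ![s.drop k ++ a', b, (s.take k).reverse ++ c] ![s ++ a', b, c] :=
    transfer (i := 2) (j := 0) (by decide) _ rfl (by simp [← List.append_assoc])
      (by simp [Fin.forall_fin_succ]) (by simp; omega)
  refine ⟨_, ?_, (((hpart.trans h₁).trans h₂).trans h₃).trans h₄⟩
  have hclog : Nat.clog 2 n = Nat.clog 2 (n - k) + 1 := by
    rw [Nat.clog_of_two_le one_lt_two hn2]
    congr 2
    omega
  have hkc : Nat.clog 2 k ≤ Nat.clog 2 (n - k) := Nat.clog_mono_right 2 (by omega)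
  have hm₁' : m₁ ≤ 4 * k * Nat.clog 2 (n - k) := hm₁.trans (Nat.mul_le_mul_left _ hkc)
  have hadd : 4 * k * Nat.clog 2 (n - k) + 4 * (n - k) * Nat.clog 2 (n - k) =
      4 * n * Nat.clog 2 (n - k) := by
    rw [← Nat.add_mul]
    congr 1
    omega
  rw [hclog, Nat.mul_succ, List.length_reverse, hstl, hlol, hn]
  omega

end ListReach

theorem List.getElem?_concat_eq_some_iff_of_ne {α : Type*} {l : List α} {x y : α} (hxy : y ≠ x)
    (m : ℕ) : (l ++ [x])[m]? = some y ↔ l[m]? = some y := by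
  rw [List.getElem?_append]
  split_ifs with hm
  · rfl
  · rw [List.getElem?_eq_none (l := l) (by omega), List.getElem?_singleton]
    split_ifs <;> simp [hxy.symm]

/-- The arrangement `π` has the contents of its stacks listed by `S`, top first. -/
def Represents {n k d : ℕ} (S : Fin k → List (Fin n)) (π : Arrangement n k d) : Prop :=
  (∀ i, (S i).length ≤ d) ∧ ∀ o i j, π.pos o = (i, j) ↔ (S i).reverse[(j.rev : ℕ)]? = some o

namespace Represents

variable {n k d : ℕ} {S T : Fin k → List (Fin n)} {π : Arrangement n k d}

theorem mem_iff (h : Represents S π) {o : Fin n} {i : Fin k} : o ∈ S i ↔ (π.pos o).1 = i := by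
  rw [← List.mem_reverse, List.mem_iff_getElem?]
  constructor
  · rintro ⟨m, hm⟩
    have hlt : m < d := by
      have := (List.getElem?_eq_some_iff.1 hm).1
      have := h.1 i
      simp at *
      omega
    rw [(h.2 o i (Fin.rev ⟨m, hlt⟩)).2 (by simpa only [Fin.rev_rev] using hm)]
  · rintro rfl
    exact ⟨_, (h.2 o _ (π.pos o).2).1 rfl⟩

theorem nodup (h : Represents S π) (i : Fin k) : (S i).Nodup := by
  rw [← List.nodup_reverse, List.nodup_iff_pairwise_ne, List.pairwise_iff_getElem]
  intro m m' hm hm' hlt heq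
  have hlen := h.1 i
  simp only [List.length_reverse] at hm hm'
  have h₁ := (h.2 _ i (Fin.rev ⟨m, by omega⟩)).2
    (by simpa only [Fin.rev_rev] using List.getElem?_eq_getElem (by simpa using hm))
  have h₂ := (h.2 _ i (Fin.rev ⟨m', by omega⟩)).2
    (by simpa only [Fin.rev_rev] using List.getElem?_eq_getElem (by simpa using hm'))
  rw [heq, h₂] at h₁
  simp at h₁
  omega

/-- A placement of the objects that agrees with some lists is an arrangement. -/
theorem exists_of_pos (hd : ∀ i, (S i).length ≤ d) (f : Fin n → Fin k × Fin d)
    (hf : ∀ o i j, f o = (i, j) ↔ (S i).reverse[(j.rev : ℕ)]? = some o) :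
    ∃ π : Arrangement n k d, Represents S π ∧ π.pos = f := by
  refine ⟨⟨f, fun o o' h => ?_, fun o j hj => ?_⟩, ⟨hd, hf⟩, rfl⟩
  · have h₁ := (hf o _ _).1 rfl
    have h₂ := (hf o' _ _).1 h.symm
    exact Option.some_injective _ (h₁.symm.trans h₂)
  · have h₁ := (hf o _ _).1 rfl
    obtain ⟨hlt, -⟩ := List.getElem?_eq_some_iff.1 h₁
    have hr : (j.rev : ℕ) ≤ ((f o).2.rev : ℕ) := Fin.rev_le_rev.2 hj
    exact ⟨(S (f o).1).reverse[(j.rev : ℕ)]'(hr.trans_lt hlt),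
      (hf _ _ _).2 (List.getElem?_eq_getElem _)⟩

theorem exists_step (h : Represents S π) (hm : ListMove d S T) :
    ∃ π' : Arrangement n k d, Represents T π' ∧ Step π π' := by
  obtain ⟨i, j, x, hij, hi, hj, hlt, hT⟩ := hm
  have hid := h.1 i
  rw [hi, List.length_cons] at hid
  have hx : π.pos x = (i, Fin.rev ⟨(T i).length, hid⟩) := by
    rw [h.2, hi]
    simp
  have hdT : ∀ l, (T l).length ≤ d := by
    intro l
    by_cases h₁ : l = i
    · subst h₁; omega
    by_cases h₂ : l = j
    · subst h₂; rw [hj, List.length_cons]; omega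
    rw [hT l h₁ h₂]
    exact h.1 l
  obtain ⟨π', hπ', hpos⟩ := exists_of_pos (S := T) hdT
    (Function.update π.pos x (j, Fin.rev ⟨(S j).length, hlt⟩)) <| by
    intro o l q
    by_cases ho : o = x
    · subst ho
      rw [Function.update_self]
      by_cases hl : l = j
      · subst hl
        have hnot : o ∉ S l := fun hmem => hij (by simpa [hx] using h.mem_iff.1 hmem)
        rw [hj, List.reverse_cons, List.getElem?_append]
        simp only [Prod.mk.injEq, true_and, List.length_reverse]
        rw [Fin.rev_eq_iff, Fin.ext_iff]
        generalize (q.rev : ℕ) = t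
        split_ifs with hq
        · simp only [hq.ne', false_iff]
          exact fun hs => hnot (List.mem_reverse.1 (List.mem_of_getElem? hs))
        · rw [List.getElem?_singleton]
          split_ifs with hq' <;> simp <;> omega
      · refine iff_of_false (fun heq => hl (congrArg Prod.fst heq).symm) fun hs => ?_
        have hmem : o ∈ T l := List.mem_reverse.1 (List.mem_of_getElem? hs)
        by_cases hl' : l = i
        · subst hl'
          have := h.nodup l
          rw [hi] at this
          exact (List.nodup_cons.1 this).1 hmem
        · rw [hT l hl' hl, h.mem_iff, hx] at hmem
          exact hl' hmem.symm
    · rw [Function.update_of_ne ho, h.2]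
      by_cases hl : l = i
      · subst hl
        rw [hi, List.reverse_cons, List.getElem?_concat_eq_some_iff_of_ne ho]
      by_cases hl' : l = j
      · subst hl'
        rw [hj, List.reverse_cons, List.getElem?_concat_eq_some_iff_of_ne ho]
      rw [hT l hl hl']
  refine ⟨π', hπ', x, ?_, ?_, ?_⟩
  · simp [hpos, hx, hij.symm]
  · intro o ho heq
    have h₁ := (h.2 o _ _).1 rfl
    rw [heq, hx, hi, List.reverse_cons, List.getElem?_concat_eq_some_iff_of_ne ho] at h₁
    rw [hx]
    obtain ⟨hm, -⟩ := List.getElem?_eq_some_iff.1 h₁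
    rw [← Fin.rev_lt_rev, Fin.rev_rev]
    simpa [Fin.lt_def] using hm
  · intro o ho
    simp [hpos, ho]

theorem exists_reach {m : ℕ} (hm : ListReach d m S T) (h : Represents S π) :
    ∃ π' : Arrangement n k d, Represents T π' ∧ Reach π π' m := by
  induction hm generalizing π with
  | refl => exact ⟨π, h, fun _ => π, rfl, rfl, by simp⟩
  | head hmove _ ih =>
    obtain ⟨π₁, h₁, hs⟩ := h.exists_step hmove
    obtain ⟨π', h', f, hf₀, hfm, hf⟩ := ih h₁
    refine ⟨π', h', fun t => t.casesOn π f, rfl, hfm, ?_⟩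
    rintro (_ | t) ht
    · simpa [hf₀] using hs
    · exact hf t (by omega)

end Represents

/-- If all objects lie in stacks `0` and `1`, these stacks are full. -/
theorem exists_represents_of_full {d : ℕ} (π : Arrangement (2 * d) 3 d)
    (hπ : ∀ o, ((π.pos o).1 : ℕ) < 2) :
    ∃ a b : List (Fin (2 * d)), a.length = d ∧ b.length = d ∧ Represents ![a, b, []] π := by
  have hsurj : ∀ (i : Fin 2) (j : Fin d), ∃ o, π.pos o = (i.castSucc, j) := by
    have hinj : Function.Injective
        (fun o => ((⟨(π.pos o).1, hπ o⟩, (π.pos o).2) : Fin 2 × Fin d)) := by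
      intro o o' h
      simp only [Prod.mk.injEq, Fin.mk.injEq] at h
      exact π.inj (Prod.ext (Fin.ext h.1) h.2)
    have hb := (Fintype.bijective_iff_injective_and_card _).2 ⟨hinj, by simp⟩
    intro i j
    obtain ⟨o, ho⟩ := hb.2 (i, j)
    simp only [Prod.mk.injEq] at ho
    exact ⟨o, Prod.ext (Fin.ext (by simp [← ho.1])) ho.2⟩
  choose g hg using hsurj
  have key : ∀ (i : Fin 2) (o : Fin (2 * d)) (j : Fin d), π.pos o = (i.castSucc, j) ↔
      (List.ofFn (g i)).reverse[(j.rev : ℕ)]? = some o := by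
    intro i o j
    have hlast : d - 1 - (d - (j + 1)) = (j : ℕ) := by omega
    rw [List.getElem?_reverse (by simp; omega)]
    simp only [List.length_ofFn, Fin.val_rev, hlast, List.getElem?_ofFn, j.2, dif_pos,
      Option.some.injEq]
    rw [← hg i j, π.inj.eq_iff, eq_comm]
  refine ⟨List.ofFn (g 0), List.ofFn (g 1), by simp, by simp, by simp [Fin.forall_fin_succ], ?_⟩
  intro o i j
  fin_cases i
  · exact key 0 o j
  · exact key 1 o j
  · simp only [Fin.reduceFinMk, Matrix.cons_val, List.reverse_nil, List.getElem?_nil,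
      reduceCtorEq, iff_false]
    intro h
    have := hπ o
    simp [h] at this

theorem natCast_clog_two_le {d : ℕ} (hd : 2 ≤ d) : (Nat.clog 2 d : ℝ) ≤ 4 * Real.log d := by
  have hlog2 : 1 / 2 < Real.log 2 := by linarith [Real.log_two_gt_d9]
  have hmono : Real.log 2 ≤ Real.log d :=
    Real.log_le_log (by norm_num) (by exact_mod_cast hd)
  have hlogb : Real.logb 2 d * Real.log 2 = Real.log d :=
    div_mul_cancel₀ _ (by linarith)
  have hone : 1 ≤ Real.logb 2 d := by
    by_contra! h
    nlinarith
  have hceil : (Nat.clog 2 d : ℝ) < Real.logb 2 d + 1 := by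
    rw [← Real.natCeil_logb_natCast]
    exact Nat.ceil_lt_add_one (by push_cast; linarith)
  nlinarith

/-- There is a universal constant `c > 0` such that for every `d ≥ 2`:
given an arrangement of `2d` objects into three stacks of capacity `d` with stacks 1 and
2 full and stack 3 empty, and any prescribed linear ordering `σ` of the objects (in
particular of those of stack 1), at most `c·d·log d` permissible pop-and-push actions
lead to an arrangement in which every object lies in its original stack (so stack 1
contains exactly its original objects, stack 2 its original set, stack 3 is empty) and
stack 1 is arranged in the order `σ` from top to bottom. -/
theorem sort_stack_dlogd :
    ∃ c : ℝ, 0 < c ∧ ∀ d : ℕ, 2 ≤ d →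
      ∀ π : Arrangement (2 * d) 3 d,
        (∀ o : Fin (2 * d), ((π.pos o).1 : ℕ) < 2) →
        ∀ σ : Fin (2 * d) → ℕ, Function.Injective σ →
          ∃ m : ℕ, (m : ℝ) ≤ c * d * Real.log d ∧
            ∃ π' : Arrangement (2 * d) 3 d,
              Reach π π' m ∧
              (∀ o, (π'.pos o).1 = (π.pos o).1) ∧
              (∀ o₁ o₂ : Fin (2 * d),
                ((π'.pos o₁).1 : ℕ) = 0 → ((π'.pos o₂).1 : ℕ) = 0 →
                σ o₁ < σ o₂ → (π'.pos o₁).2 < (π'.pos o₂).2) := by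
  refine ⟨16, by norm_num, fun d hd π hπ σ _ => ?_⟩
  obtain ⟨a, b, ha, hb, hrep⟩ := exists_represents_of_full π hπ
  have hnd : a.Nodup := hrep.nodup 0
  set r : Fin (2 * d) → Fin (2 * d) → Prop := fun x y => σ x ≤ σ y
  have : Std.Total r := ⟨fun x y => le_total _ _⟩
  have : IsTrans _ r := ⟨fun x y z h h' => le_trans h h'⟩
  set s := a.insertionSort r
  have hsa : s.Perm a := List.perm_insertionSort r a
  have hsort : s.Pairwise r := List.pairwise_insertionSort r a
  obtain ⟨m, hm, hreach⟩ := ListReach.permute (d := d) s a [] b [] hsa (hsa.nodup_iff.2 hnd)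
    (by simp [ha]) (by omega) (by omega) (by simp [ha])
  simp only [List.append_nil] at hreach
  obtain ⟨π', hrep', hπ'⟩ := hrep.exists_reach hreach
  refine ⟨m, ?_, π', hπ', fun o => ?_, fun o₁ o₂ h₁ h₂ hlt => ?_⟩
  · rw [ha] at hm
    calc (m : ℝ) ≤ 4 * d * Nat.clog 2 d := by exact_mod_cast hm
      _ ≤ 4 * d * (4 * Real.log d) := by gcongr; exact natCast_clog_two_le hd
      _ = 16 * d * Real.log d := by ring
  · have hmem : ∀ i, o ∈ (![s, b, []] : Fin 3 → List _) i ↔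
        o ∈ (![a, b, []] : Fin 3 → List _) i := by
      simp [Fin.forall_fin_succ, hsa.mem_iff]
    exact hrep'.mem_iff.1 ((hmem _).2 (hrep.mem_iff.2 rfl))
  · have g₁ : s.reverse[((π'.pos o₁).2.rev : ℕ)]? = some o₁ :=
      (hrep'.2 o₁ 0 _).1 (Prod.ext (Fin.ext h₁) rfl)
    have g₂ : s.reverse[((π'.pos o₂).2.rev : ℕ)]? = some o₂ :=
      (hrep'.2 o₂ 0 _).1 (Prod.ext (Fin.ext h₂) rfl)
    by_contra! hle
    rcases hle.eq_or_lt with heq | hlt'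
    · rw [heq] at g₂
      have := Option.some_injective _ (g₁.symm.trans g₂)
      simp [this] at hlt
    · obtain ⟨l₁, e₁⟩ := List.getElem?_eq_some_iff.1 g₁
      obtain ⟨l₂, e₂⟩ := List.getElem?_eq_some_iff.1 g₂
      have hr : σ _ ≤ σ _ := List.pairwise_iff_getElem.1 (List.pairwise_reverse.2 hsort) _ _ l₁ l₂
        (Fin.rev_lt_rev.2 hlt')
      rw [e₁, e₂] at hr
      exact hlt.not_ge hr
end

section
/- There exists a universal constant c > 0 such that for all integers w ≥ 2 and d ≥ 1, every LSR instance with n ≤ wd objects in w+1 stacks of capacity d has a solution consisting of at most c · w · d · (1 + max(log d, log w)) permissible pop-and-push actions. -/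
section Stacks

open Function

variable {ι α : Type*} [DecidableEq ι]

/-- `Moves d s s' m`: the family of stacks `s` (lists with the top at the head) can be turned into
`s'` by at most `m` pop-and-push actions respecting the capacity `d`. -/
inductive Moves (d : ℕ) : (ι → List α) → (ι → List α) → ℕ → Prop
  | refl (s : ι → List α) (m : ℕ) : Moves d s s m
  | step {s s' : ι → List α} {m : ℕ} (i j : ι) (a : α) (t : List α) (hij : i ≠ j)
      (hi : s i = a :: t) (hj : (s j).length < d)
      (h : Moves d (update (update s i t) j (a :: s j)) s' m) : Moves d s s' (m + 1)

namespace Moves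

variable {d : ℕ}

theorem mono {s s' : ι → List α} {m m' : ℕ} (h : Moves d s s' m) (hm : m ≤ m') :
    Moves d s s' m' := by
  induction h generalizing m' with
  | refl s m => exact .refl s m'
  | step i j a t hij hi hj _ ih =>
    obtain ⟨k, rfl⟩ : ∃ k, m' = k + 1 := ⟨m' - 1, by omega⟩
    exact .step i j a t hij hi hj (ih (by omega))

theorem trans {s₁ s₂ s₃ : ι → List α} {m m' : ℕ} (h : Moves d s₁ s₂ m) (h' : Moves d s₂ s₃ m') :
    Moves d s₁ s₃ (m + m') := by
  induction h with
  | refl s m => exact h'.mono (by omega)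
  | step i j a t hij hi hj _ ih =>
    rw [Nat.add_right_comm]
    exact .step i j a t hij hi hj (ih h')

/-- Pouring the top segment `l` of stack `i` onto stack `j` reverses it. -/
theorem pour {i j : ι} (hij : i ≠ j) (l t : List α) {s s' : ι → List α} (hi : s i = l ++ t)
    (hj : (s j).length + l.length ≤ d) (hi' : s' i = t) (hj' : s' j = l.reverse ++ s j)
    (hs : ∀ k, k ≠ i → k ≠ j → s' k = s k) : Moves d s s' l.length := by
  induction l generalizing s with
  | nil =>
    have : s = s' := by
      funext k
      by_cases h1 : k = i
      · subst h1; simp_all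
      · by_cases h2 : k = j
        · subst h2; simp_all
        · exact (hs k h1 h2).symm
    rw [this]; exact .refl _ _
  | cons a l ih =>
    simp only [List.length_cons] at hj ⊢
    refine .step i j a (l ++ t) hij hi (by omega) (ih ?_ ?_ ?_ ?_)
    · simp [update_of_ne hij]
    · simp; omega
    · simp [hj']
    · intro k h1 h2
      simp [h1, h2, hs k h1 h2]

/-- Distributing the top segment `l` of stack `i` onto the stacks `j` and `k`, according to `p`. -/
theorem distribute {i j k : ι} (hij : i ≠ j) (hik : i ≠ k) (hjk : j ≠ k) (p : α → Prop)
    [DecidablePred p] (l t : List α) {s s' : ι → List α} (hi : s i = l ++ t)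
    (hj : (s j).length + (l.filter (p ·)).length ≤ d)
    (hk : (s k).length + (l.filter (¬ p ·)).length ≤ d)
    (hi' : s' i = t) (hj' : s' j = (l.filter (p ·)).reverse ++ s j)
    (hk' : s' k = (l.filter (¬ p ·)).reverse ++ s k)
    (hs : ∀ x, x ≠ i → x ≠ j → x ≠ k → s' x = s x) : Moves d s s' l.length := by
  induction l generalizing s with
  | nil =>
    have : s = s' := by
      funext x
      by_cases h1 : x = i
      · subst h1; simp_all
      · by_cases h2 : x = j
        · subst h2; simp_all
        · by_cases h3 : x = k
          · subst h3; simp_all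
          · exact (hs x h1 h2 h3).symm
    rw [this]; exact .refl _ _
  | cons a l ih =>
    by_cases hp : p a
    · simp only [hp, List.filter_cons, decide_true, not_true_eq_false, decide_false, if_true,
        Bool.false_eq_true, if_false, List.length_cons] at hj hk hj' hk' ⊢
      refine .step i j a (l ++ t) hij hi (by omega) (ih ?_ ?_ ?_ ?_ ?_ ?_)
      · simp [update_of_ne hij]
      · simp at hj ⊢; omega
      · simp [hjk.symm, hik.symm] at hk ⊢; omega
      · simp [hj']
      · simp [hk', hjk.symm, hik.symm]
      · intro x h1 h2 h3
        simp [h1, h2, hs x h1 h2 h3]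
    · simp only [hp, List.filter_cons, decide_true, not_false_eq_true, decide_false, if_true,
        Bool.false_eq_true, if_false, List.length_cons] at hj hk hj' hk' ⊢
      refine .step i k a (l ++ t) hik hi (by omega) (ih ?_ ?_ ?_ ?_ ?_ ?_)
      · simp [update_of_ne hik]
      · simp [hjk, hij.symm] at hj ⊢; omega
      · simp at hk ⊢; omega
      · simp [hj', hjk, hij.symm]
      · simp [hk']
      · intro x h1 h2 h3
        simp [h1, h3, hs x h1 h2 h3]

/-- With the help of a full stack `b` and the empty stack `e`, the full stack `a` can be stably
partitioned in linear time. -/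
theorem partition {a b e : ι} (hab : a ≠ b) (hae : a ≠ e) (hbe : b ≠ e) (p : α → Prop)
    [DecidablePred p] (s : ι → List α) (ha : (s a).length = d) (hb : (s b).length = d)
    (he : s e = []) :
    Moves d s (update s a ((s a).filter (p ·) ++ (s a).filter (¬ p ·))) (4 * d) := by
  set P := (s a).filter (p ·) with hP
  set Q := (s a).filter (¬ p ·) with hQ
  have hPQ : P.length + Q.length = d := by
    rw [← ha, hP, hQ]
    simpa using (List.length_eq_length_filter_add (l := s a) (fun x => decide (p x))).symm
  set u := (s b).take P.length
  set v := (s b).drop P.length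
  have huv : s b = u ++ v := (List.take_append_drop _ _).symm
  have hu : u.length = P.length := by simp [u]; omega
  have hv : v.length = Q.length := by simp [v]; omega
  have h1 : Moves d s (update (update s b v) e u.reverse) u.length :=
    pour hbe u v huv (by simp [he]; omega) (by simp [hbe]) (by simp [he])
      (by intro k h1 h2; simp [h1, h2])
  have h2 : Moves d (update (update s b v) e u.reverse)
      (update (update (update s a []) b (P.reverse ++ v)) e (Q.reverse ++ u.reverse))
      (s a).length :=
    distribute hab hae hbe p (s a) [] (by simp [hab, hae])
      (by simp [hbe, ← hP]; omega) (by simp only [update_self, ← hQ, List.length_reverse]; omega)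
      (by simp [hab, hae]) (by simp [hbe, ← hP]) (by simp [hQ])
      (by intro k h1 h2 h3; simp [h1, h2, h3])
  have h3 : Moves d
      (update (update (update s a []) b (P.reverse ++ v)) e (Q.reverse ++ u.reverse))
      (update (update (update s a Q) b (P.reverse ++ v)) e u.reverse) Q.reverse.length :=
    pour hae.symm Q.reverse u.reverse (by simp) (by simp [hab, hae]; omega) (by simp)
      (by simp [hab, hae]) (by intro k h1 h2; simp [h1, h2, update_apply])
  have h4 : Moves d
      (update (update (update s a Q) b (P.reverse ++ v)) e u.reverse)
      (update (update (update s a (P ++ Q)) b v) e u.reverse) P.reverse.length :=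
    pour hab.symm P.reverse v (by simp [hbe]) (by simp [hab, hae]; omega) (by simp [hbe])
      (by simp [hab, hae]) (by intro k h1 h2; simp [h1, h2, update_apply])
  have h5 : Moves d
      (update (update (update s a (P ++ Q)) b v) e u.reverse)
      (update s a (P ++ Q)) u.reverse.length :=
    pour hbe.symm u.reverse [] (by simp) (by simp [hbe]; omega) (by simp [hae.symm, he])
      (by simp [hab.symm, hbe, huv]) (by intro k h1 h2; simp [h1, h2, update_apply])
  refine ((((h1.trans h2).trans h3).trans h4).trans h5).mono ?_
  simp only [List.length_reverse]
  omega

/-- If `p` holds for at least `d` objects of two partitioned stacks, then one of the stacks can be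
made to consist of such objects only. -/
theorem merge {a b e : ι} (hab : a ≠ b) (hae : a ≠ e) (hbe : b ≠ e) (s : ι → List α)
    {P Q P' Q' : List α} (hsa : s a = P ++ Q) (hsb : s b = P' ++ Q')
    (ha : (s a).length = d) (hb : (s b).length = d) (he : s e = [])
    (hd : d ≤ P.length + P'.length) :
    Moves d s (update (update s a (P ++ P'.take (d - P.length))) b
      (Q.reverse ++ (P'.drop (d - P.length) ++ Q'))) (3 * d) := by
  set u := P'.take (d - P.length)
  set v := P'.drop (d - P.length)
  have huv : P' = u ++ v := (List.take_append_drop _ _).symm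
  rw [hsa, List.length_append] at ha
  have hb' := hb
  rw [hsb, List.length_append] at hb'
  have hu : u.length = Q.length := by simp [u]; omega
  have hv : v.length + Q'.length = P.length := by simp [v]; omega
  have h1 : Moves d s (update (update s a Q) e P.reverse) P.length :=
    pour hae P Q hsa (by simp [he]; omega) (by simp [hae]) (by simp [he])
      (by intro k h1 h2; simp [h1, h2])
  have h2 : Moves d (update (update s a Q) e P.reverse)
      (update (update (update s a Q) b (v ++ Q')) e (u.reverse ++ P.reverse)) u.length :=
    pour hbe u (v ++ Q') (by simp [hbe, hab.symm, hsb, huv]) (by simp; omega) (by simp [hbe])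
      (by simp) (by intro k h1 h2; simp [h1, h2, update_apply])
  have h3 : Moves d (update (update (update s a Q) b (v ++ Q')) e (u.reverse ++ P.reverse))
      (update (update (update s a []) b (Q.reverse ++ (v ++ Q'))) e (u.reverse ++ P.reverse))
      Q.length :=
    pour hab Q [] (by simp [hab, hae]) (by simp [hbe]; omega) (by simp [hab, hae])
      (by simp [hbe]) (by intro k h1 h2; simp [h1, h2, update_apply])
  have h4 : Moves d
      (update (update (update s a []) b (Q.reverse ++ (v ++ Q'))) e (u.reverse ++ P.reverse))
      (update (update s a (P ++ u)) b (Q.reverse ++ (v ++ Q')))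
      (u.reverse ++ P.reverse).length :=
    pour hae.symm (u.reverse ++ P.reverse) [] (by simp) (by simp [hab, hae]; omega)
      (by simp [hae.symm, hbe.symm, he])
      (by simp [hab, hae]) (by intro k h1 h2; simp [h1, h2, update_apply])
  refine (((h1.trans h2).trans h3).trans h4).mono ?_
  simp only [List.length_reverse, List.length_append]
  omega

/-- If `p` holds for at least `d` objects of two full stacks, then one of them can be filled with
such objects. -/
theorem exists_pure_stack {a b e : ι} (hab : a ≠ b) (hae : a ≠ e) (hbe : b ≠ e) (p : α → Prop)
    [DecidablePred p] (s : ι → List α) (ha : (s a).length = d) (hb : (s b).length = d)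
    (he : s e = []) (hd : d ≤ (s a).countP (p ·) + (s b).countP (p ·)) :
    ∃ a' b' : List α, Moves d s (update (update s a a') b b') (11 * d) ∧ a'.length = d ∧
      b'.length = d ∧ (∀ x ∈ a', p x) ∧ (a' : Multiset α) + b' = s a + s b := by
  have len (l : List α) : (l.filter (p ·)).length + (l.filter (¬ p ·)).length = l.length := by
    simpa using (List.length_eq_length_filter_add (l := l) (fun x => decide (p x))).symm
  have perm (l : List α) : (↑(l.filter (p ·)) : Multiset α) + ↑(l.filter (¬ p ·)) = l := by
    simpa using List.filter_append_perm (fun x => decide (p x)) l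
  have hla := len (s a)
  have hlb := len (s b)
  have hpa := perm (s a)
  have hpb := perm (s b)
  rw [List.countP_eq_length_filter, List.countP_eq_length_filter] at hd
  have h1 := partition hab hae hbe p s ha hb he
  have h2 := partition (d := d) hab.symm hbe hae p
    (update s a ((s a).filter (p ·) ++ (s a).filter (¬ p ·)))
    (by simp [hab.symm, hb]) (by simp only [update_self, List.length_append]; omega)
    (by simp [hae.symm, he])
  simp only [update_of_ne hab.symm] at h2
  have hP : ∀ x ∈ (s a).filter (p ·), p x := by simp
  have hP' : ∀ x ∈ (s b).filter (p ·), p x := by simp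
  set P := (s a).filter (p ·)
  set Q := (s a).filter (¬ p ·)
  set P' := (s b).filter (p ·)
  set Q' := (s b).filter (¬ p ·)
  have h3 := merge (d := d) hab hae hbe (update (update s a (P ++ Q)) b (P' ++ Q'))
    (P := P) (Q := Q) (P' := P') (Q' := Q') (by simp [hab]) (by simp)
    (by simp [hab]; omega) (by simp; omega) (by simp [hae.symm, hbe.symm, he]) hd
  refine ⟨P ++ P'.take (d - P.length), Q.reverse ++ (P'.drop (d - P.length) ++ Q'), ?_, ?_, ?_,
    ?_, ?_⟩
  · have := ((h1.trans h2).trans h3).mono (m' := 11 * d) (by omega)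
    convert this using 1
    funext k
    simp only [update_apply]
    split_ifs <;> rfl
  · simp; omega
  · simp; omega
  · intro x hx
    rcases List.mem_append.1 hx with h | h
    · exact hP x h
    · exact hP' x (List.mem_of_mem_take h)
  · rw [← hpa, ← hpb]
    have : (P' : Multiset α) = ↑(P'.take (d - P.length)) + ↑(P'.drop (d - P.length)) := by simp
    rw [this, ← Multiset.coe_add, ← Multiset.coe_add, ← Multiset.coe_add, Multiset.coe_reverse]
    abel

/-- The objects satisfying `p` can be collected in the stacks `S` and the others in `T`, using a
linear number of moves. -/
theorem separate {e : ι} (p : α → Prop) [DecidablePred p] (m : ℕ) (S T : Finset ι)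
    (hm : S.card + T.card = m) (hST : Disjoint S T) (heS : e ∉ S) (heT : e ∉ T) (s : ι → List α)
    (he : s e = []) (hS : ∀ i ∈ S, (s i).length = d) (hT : ∀ i ∈ T, (s i).length = d)
    (hp : Multiset.countP p (∑ i ∈ S, (s i : Multiset α) + ∑ i ∈ T, (s i : Multiset α)) =
      S.card * d) :
    ∃ s' : ι → List α, Moves d s s' (11 * d * m) ∧ (∀ i, i ∉ S → i ∉ T → s' i = s i) ∧
      (∀ i ∈ S, (s' i).length = d ∧ ∀ x ∈ s' i, p x) ∧
      (∀ i ∈ T, (s' i).length = d ∧ ∀ x ∈ s' i, ¬ p x) ∧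
      ∑ i ∈ S, (s' i : Multiset α) + ∑ i ∈ T, (s' i : Multiset α) =
        ∑ i ∈ S, (s i : Multiset α) + ∑ i ∈ T, (s i : Multiset α) := by
  induction m generalizing S T s with
  | zero =>
    obtain ⟨h1, h2⟩ : S.card = 0 ∧ T.card = 0 := by omega
    rw [Finset.card_eq_zero] at h1 h2
    subst h1 h2
    exact ⟨s, .refl _ _, by simp, by simp, by simp, rfl⟩
  | succ m ih =>
    rcases S.eq_empty_or_nonempty with rfl | ⟨a, haS⟩
    · refine ⟨s, .refl _ _, by simp, by simp, fun i hi => ⟨hT i hi, fun x hx => ?_⟩, rfl⟩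
      simp only [Finset.sum_empty, zero_add, Finset.card_empty, zero_mul,
        Multiset.countP_eq_zero] at hp
      exact hp x (Multiset.mem_sum.2 ⟨i, hi, by simpa using hx⟩)
    rcases T.eq_empty_or_nonempty with rfl | ⟨b, hbT⟩
    · refine ⟨s, .refl _ _, by simp, fun i hi => ⟨hS i hi, fun x hx => ?_⟩, by simp, rfl⟩
      have hc : S.card * d = (∑ i ∈ S, (s i : Multiset α)).card := by
        rw [Multiset.card_sum, Finset.sum_congr rfl (g := fun _ => d) (by simpa using hS)]
        simp
      rw [Finset.sum_empty, add_zero, hc, Multiset.countP_eq_card] at hp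
      exact hp x (Multiset.mem_sum.2 ⟨i, hi, by simpa using hx⟩)
    have hab : a ≠ b := fun h => Finset.disjoint_left.1 hST haS (h ▸ hbT)
    have hae : a ≠ e := fun h => heS (h ▸ haS)
    have hbe : b ≠ e := fun h => heT (h ▸ hbT)
    have haT : a ∉ T := Finset.disjoint_left.1 hST haS
    have hbS : b ∉ S := Finset.disjoint_right.1 hST hbT
    have hcS := Finset.card_erase_add_one haS
    have hcT := Finset.card_erase_add_one hbT
    have split (a' b' : List α) (hsum : (a' : Multiset α) + b' = s a + s b) :
        (a' : Multiset α) + ∑ i ∈ S.erase a, (update (update s a a') b b' i : Multiset α) +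
          (b' + ∑ i ∈ T.erase b, (update (update s a a') b b' i : Multiset α)) =
        ∑ i ∈ S, (s i : Multiset α) + ∑ i ∈ T, (s i : Multiset α) := by
      rw [← Finset.add_sum_erase S _ haS, ← Finset.add_sum_erase T _ hbT,
        add_add_add_comm, hsum, add_add_add_comm]
      congr 2
      · refine Finset.sum_congr rfl fun i hi => ?_
        rw [update_of_ne, update_of_ne (Finset.ne_of_mem_erase hi)]
        rintro rfl; exact hbS (Finset.mem_of_mem_erase hi)
      · refine Finset.sum_congr rfl fun i hi => ?_
        rw [update_of_ne (Finset.ne_of_mem_erase hi), update_of_ne]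
        rintro rfl; exact haT (Finset.mem_of_mem_erase hi)
    have hla := hS a haS
    have hlb := hT b hbT
    have ca := List.length_eq_countP_add_countP (l := s a) (fun x => decide (p x))
    have cb := List.length_eq_countP_add_countP (l := s b) (fun x => decide (p x))
    by_cases hd : d ≤ (s a).countP (p ·) + (s b).countP (p ·)
    · obtain ⟨a', b', hmov, hla', hlb', hpa', hsum⟩ :=
        exists_pure_stack hab hae hbe p s hla hlb he hd
      set s₁ := update (update s a a') b b' with hs₁
      have h1a : s₁ a = a' := by simp [hs₁, hab]
      have h1b : s₁ b = b' := by simp [hs₁]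
      have h1 : ∀ i, i ≠ a → i ≠ b → s₁ i = s i := fun i h1 h2 => by simp [hs₁, h1, h2]
      have hsp := split a' b' hsum
      rw [← hs₁, ← h1b, Finset.add_sum_erase T (fun i => (s₁ i : Multiset α)) hbT] at hsp
      have hpc : Multiset.countP p (a' : Multiset α) = d := by
        rw [← hla', ← Multiset.coe_card, Multiset.countP_eq_card]
        simpa using hpa'
      obtain ⟨s', hm', h2, h3, h4, h5⟩ := ih (S.erase a) T (by omega)
        (hST.mono_left (Finset.erase_subset _ _)) (fun h => heS (Finset.mem_of_mem_erase h)) heT s₁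
        (by rw [h1 e hae.symm hbe.symm, he])
        (fun i hi => by
          rw [h1 i (Finset.ne_of_mem_erase hi)
            (fun h => hbS (h ▸ Finset.mem_of_mem_erase hi)), hS i (Finset.mem_of_mem_erase hi)])
        (fun i hi => by
          by_cases h : i = b
          · rw [h, h1b, hlb']
          · rw [h1 i (fun h => haT (h ▸ hi)) h, hT i hi])
        (by
          rw [← hsp, add_assoc, Multiset.countP_add, hpc, ← hcS, add_mul] at hp
          omega)
      have h2a : s' a = a' := by rw [h2 a (by simp) haT, h1a]
      refine ⟨s', (hmov.trans hm').mono (by rw [mul_add]; omega), ?_, ?_, h4, ?_⟩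
      · intro i hi hi'
        rw [h2 i (fun h => hi (Finset.mem_of_mem_erase h)) hi',
          h1 i (fun h => hi (h ▸ haS)) (fun h => hi' (h ▸ hbT))]
      · intro i hi
        by_cases h : i = a
        · subst h; rw [h2a]; exact ⟨hla', hpa'⟩
        · exact h3 i (Finset.mem_erase.2 ⟨h, hi⟩)
      · rw [← Finset.add_sum_erase S _ haS, h2a, add_assoc, h5, ← hsp, add_assoc]
    · obtain ⟨b', a', hmov, hlb', hla', hpb', hsum⟩ :=
        exists_pure_stack hab.symm hbe hae (¬ p ·) s hlb hla he (by
          simp only [decide_not, decide_eq_true_eq] at ca cb hd ⊢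
          omega)
      rw [update_comm hab.symm] at hmov
      set s₁ := update (update s a a') b b' with hs₁
      have h1a : s₁ a = a' := by simp [hs₁, hab]
      have h1b : s₁ b = b' := by simp [hs₁]
      have h1 : ∀ i, i ≠ a → i ≠ b → s₁ i = s i := fun i h1 h2 => by simp [hs₁, h1, h2]
      have hsp := split a' b' (by rw [add_comm, hsum, add_comm])
      rw [← hs₁, ← h1a, Finset.add_sum_erase S (fun i => (s₁ i : Multiset α)) haS,
        add_left_comm] at hsp
      have hpc : Multiset.countP p (b' : Multiset α) = 0 := by
        rw [Multiset.countP_eq_zero]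
        simpa using hpb'
      obtain ⟨s', hm', h2, h3, h4, h5⟩ := ih S (T.erase b) (by omega)
        (hST.mono_right (Finset.erase_subset _ _)) heS (fun h => heT (Finset.mem_of_mem_erase h)) s₁
        (by rw [h1 e hae.symm hbe.symm, he])
        (fun i hi => by
          by_cases h : i = a
          · rw [h, h1a, hla']
          · rw [h1 i h (fun h => hbS (h ▸ hi)), hS i hi])
        (fun i hi => by
          rw [h1 i (fun h => haT (h ▸ Finset.mem_of_mem_erase hi))
            (Finset.ne_of_mem_erase hi), hT i (Finset.mem_of_mem_erase hi)])
        (by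
          rw [← hsp, Multiset.countP_add, hpc] at hp
          omega)
      have h2b : s' b = b' := by rw [h2 b hbS (by simp), h1b]
      refine ⟨s', (hmov.trans hm').mono (by rw [mul_add]; omega), ?_, h3, ?_, ?_⟩
      · intro i hi hi'
        rw [h2 i hi (fun h => hi' (Finset.mem_of_mem_erase h)),
          h1 i (fun h => hi (h ▸ haS)) (fun h => hi' (h ▸ hbT))]
      · intro i hi
        by_cases h : i = b
        · subst h; rw [h2b]; exact ⟨hlb', hpb'⟩
        · exact h4 i (Finset.mem_erase.2 ⟨h, hi⟩)
      · rw [← Finset.add_sum_erase T _ hbT, h2b, add_left_comm, h5, ← hsp]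

/-- Every object can be brought to its target stack `τ x`. -/
theorem sort_stacks {e : ι} (τ : α → ι) (k : ℕ) (S : Finset ι) (hk : S.card ≤ 2 ^ k)
    (heS : e ∉ S) (s : ι → List α) (he : s e = []) (hS : ∀ i ∈ S, (s i).length = d)
    (hτ : ∀ i ∈ S, ∀ x ∈ s i, τ x ∈ S)
    (hc : ∀ i ∈ S, Multiset.countP (τ · = i) (∑ i ∈ S, (s i : Multiset α)) = d) :
    ∃ s' : ι → List α, Moves d s s' (11 * d * (S.card * k)) ∧ (∀ i, i ∉ S → s' i = s i) ∧
      (∀ i ∈ S, (s' i).length = d ∧ ∀ x ∈ s' i, τ x = i) ∧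
      ∑ i ∈ S, (s' i : Multiset α) = ∑ i ∈ S, (s i : Multiset α) := by
  induction k generalizing S s with
  | zero =>
    refine ⟨s, .refl _ _, by simp, fun i hi => ⟨hS i hi, fun x hx => ?_⟩, rfl⟩
    exact Finset.card_le_one.1 (by simpa using hk) _ (hτ i hi x hx) _ hi
  | succ k ih =>
    obtain ⟨U, hUS, hU⟩ := Finset.exists_subset_card_eq (s := S) (n := S.card / 2) (by omega)
    set V := S \ U with hV
    have hUV : Disjoint U V := Finset.disjoint_sdiff
    have hUVS : U ∪ V = S := Finset.union_sdiff_of_subset hUS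
    have hcard : U.card + V.card = S.card := by rw [← hUVS, Finset.card_union_of_disjoint hUV]
    have hVS : V ⊆ S := Finset.sdiff_subset
    have hsum (t : ι → List α) : ∑ i ∈ S, (t i : Multiset α) =
        ∑ i ∈ U, (t i : Multiset α) + ∑ i ∈ V, (t i : Multiset α) := by
      rw [← hUVS, Finset.sum_union hUV]
    have hcount (M : Multiset α) (W : Finset ι) (hW : ∀ i ∈ W, M.countP (τ · = i) = d) :
        M.countP (τ · ∈ W) = W.card * d := by
      induction W using Finset.induction_on with
      | empty => simp
      | insert a W ha ihW =>
        rw [Finset.card_insert_of_notMem ha, add_mul, one_mul,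
          ← ihW (fun i hi => hW i (Finset.mem_insert_of_mem hi)),
          ← hW a (Finset.mem_insert_self _ _)]
        clear hW ihW
        simp only [Finset.mem_insert]
        induction M using Multiset.induction_on with
        | empty => simp
        | cons x M ihM =>
          simp only [Multiset.countP_cons, ihM]
          by_cases h1 : τ x = a
          · simp only [h1, ha, true_or, if_true, if_false]; omega
          · simp only [h1, false_or, if_false]; omega
    obtain ⟨s₁, hm₁, h1, h2, h3, h4⟩ := separate (e := e) (d := d) (τ · ∈ U) _ U V rfl hUV
      (fun h => heS (hUS h)) (fun h => heS (hVS h)) s he (fun i hi => hS i (hUS hi))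
      (fun i hi => hS i (hVS hi)) (by
        rw [← hsum]
        exact hcount _ _ fun i hi => hc i (hUS hi))
    have hτ₁ : ∀ i ∈ S, ∀ x ∈ s₁ i, τ x ∈ S := by
      intro i hi x hx
      have : x ∈ ∑ i ∈ S, (s₁ i : Multiset α) := Multiset.mem_sum.2 ⟨i, hi, by simpa using hx⟩
      rw [hsum, h4, ← hsum, Multiset.mem_sum] at this
      obtain ⟨j, hj, hx⟩ := this
      exact hτ j hj x (by simpa using hx)
    have hτV : ∀ i ∈ V, ∀ x ∈ s₁ i, τ x ∈ V := fun i hi x hx =>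
      Finset.mem_sdiff.2 ⟨hτ₁ i (hVS hi) x hx, (h3 i hi).2 x hx⟩
    have hzero (W W' : Finset ι) (hW : Disjoint W W') (h : ∀ i ∈ W', ∀ x ∈ s₁ i, τ x ∈ W') :
        ∀ i ∈ W, Multiset.countP (τ · = i) (∑ i ∈ W', (s₁ i : Multiset α)) = 0 := by
      intro i hi
      rw [Multiset.countP_eq_zero]
      rintro x hx rfl
      obtain ⟨j, hj, hx⟩ := Multiset.mem_sum.1 hx
      exact Finset.disjoint_left.1 hW hi (h j hj x (by simpa using hx))
    have hc₁ : ∀ i ∈ S, Multiset.countP (τ · = i) (∑ i ∈ U, (s₁ i : Multiset α)) +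
        Multiset.countP (τ · = i) (∑ i ∈ V, (s₁ i : Multiset α)) = d := by
      intro i hi
      rw [← Multiset.countP_add, h4, ← hsum, hc i hi]
    have hk2 : S.card ≤ 2 * 2 ^ k := by rw [pow_succ] at hk; omega
    obtain ⟨s₂, hm₂, h5, h6, h7⟩ := ih U (by omega) (fun h => heS (hUS h)) s₁
      (by rw [h1 e (fun h => heS (hUS h)) (fun h => heS (hVS h)), he])
      (fun i hi => (h2 i hi).1) (fun i hi => (h2 i hi).2)
      (fun i hi => by
        have := hc₁ i (hUS hi)
        rwa [hzero U V hUV hτV i hi, add_zero] at this)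
    have h52 : ∀ i ∈ V, s₂ i = s₁ i := fun i hi => h5 i (Finset.disjoint_right.1 hUV hi)
    have h52' : ∑ i ∈ V, (s₂ i : Multiset α) = ∑ i ∈ V, (s₁ i : Multiset α) :=
      Finset.sum_congr rfl fun i hi => by rw [h52 i hi]
    obtain ⟨s₃, hm₃, h8, h9, h10⟩ := ih V (by omega) (fun h => heS (hVS h)) s₂
      (by rw [h5 e (fun h => heS (hUS h)), h1 e (fun h => heS (hUS h)) (fun h => heS (hVS h)), he])
      (fun i hi => by rw [h52 i hi]; exact (h3 i hi).1)
      (fun i hi => by rw [h52 i hi]; exact hτV i hi)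
      (fun i hi => by
        have := hc₁ i (hVS hi)
        rwa [hzero V U hUV.symm (fun i hi => (h2 i hi).2) i hi, zero_add, ← h52'] at this)
    have h83 : ∀ i ∈ U, s₃ i = s₂ i := fun i hi => h8 i (Finset.disjoint_left.1 hUV hi)
    refine ⟨s₃, ((hm₁.trans hm₂).trans hm₃).mono ?_, ?_, ?_, ?_⟩
    · rw [hcard, ← mul_add, ← mul_add, ← hcard]
      apply le_of_eq
      ring
    · intro i hi
      rw [h8 i (fun h => hi (hVS h)), h5 i (fun h => hi (hUS h)),
        h1 i (fun h => hi (hUS h)) (fun h => hi (hVS h))]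
    · intro i hi
      by_cases h : i ∈ U
      · rw [h83 i h]; exact h6 i h
      · exact h9 i (Finset.mem_sdiff.2 ⟨hi, h⟩)
    · rw [hsum, h10, h52', Finset.sum_congr rfl (fun i hi => by rw [h83 i hi]), h7, h4, ← hsum]

/-- Radix sort of a single stack. -/
theorem radix_sort {a b e : ι} (hab : a ≠ b) (hae : a ≠ e) (hbe : b ≠ e) (r : α → ℕ)
    (s : ι → List α) (ha : (s a).length = d) (hb : (s b).length = d) (he : s e = []) (k : ℕ) :
    ∃ l : List α, l.Perm (s a) ∧ Moves d s (update s a l) (4 * d * k) ∧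
      l.Pairwise (fun x y => r x % 2 ^ k ≤ r y % 2 ^ k) := by
  induction k with
  | zero => exact ⟨s a, .refl _, by simpa using .refl _ _, by
    simp only [pow_zero, Nat.mod_one, le_refl]
    exact List.pairwise_of_forall fun _ _ => trivial⟩
  | succ k ih =>
    obtain ⟨l, hl, hm, hp⟩ := ih
    have h := partition (d := d) hab hae hbe (fun x => r x / 2 ^ k % 2 = 0) (update s a l)
      (by simp [hl.length_eq, ha]) (by simp [hab.symm, hb]) (by simp [hae.symm, he])
    simp only [update_self, update_idem] at h
    refine ⟨_, ?_, (hm.trans h).mono (le_of_eq (by ring)), ?_⟩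
    · refine List.Perm.trans ?_ hl
      simpa only [decide_not] using
        List.filter_append_perm (fun x => decide (r x / 2 ^ k % 2 = 0)) l
    · simp only [Nat.mod_pow_succ]
      rw [List.pairwise_append]
      refine ⟨?_, ?_, ?_⟩
      · rw [List.pairwise_filter]
        refine hp.imp fun {x y} h hx hy => ?_
        simp only [decide_eq_true_eq] at hx hy
        simpa [hx, hy] using h
      · rw [List.pairwise_filter]
        refine hp.imp fun {x y} h hx hy => ?_
        simp only [decide_eq_true_eq, Nat.mod_two_not_eq_zero] at hx hy
        simpa [hx, hy] using h
      · intro x hx y hy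
        simp only [List.mem_filter, decide_eq_true_eq, Nat.mod_two_not_eq_zero] at hx hy
        rw [hx.2, hy.2]
        have := Nat.mod_lt (r x) (Nat.two_pow_pos k)
        omega

theorem sort_stack {a b e : ι} (hab : a ≠ b) (hae : a ≠ e) (hbe : b ≠ e) (r : α → ℕ)
    (s : ι → List α) (ha : (s a).length = d) (hb : (s b).length = d) (he : s e = [])
    (l : List α) (hl : l.Perm (s a)) (hr : l.Pairwise (fun x y => r x < r y))
    (hd : ∀ x ∈ l, r x < d) :
    Moves d s (update s a l) (4 * d * Nat.clog 2 d) := by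
  obtain ⟨l', hl', hm, hp⟩ := radix_sort hab hae hbe r s ha hb he (Nat.clog 2 d)
  have hperm := hl'.trans hl.symm
  have hd' : ∀ x ∈ l', r x < 2 ^ Nat.clog 2 d := fun x hx =>
    (hd x (hperm.subset hx)).trans_le (Nat.le_pow_clog one_lt_two d)
  have hinj : ∀ x ∈ l, ∀ y ∈ l, r x = r y → x = y := by
    intro x hx y hy hxy
    have : (l.map r).Nodup := List.pairwise_map.2 (hr.imp fun h => h.ne)
    exact List.inj_on_of_nodup_map this hx hy hxy
  have : l' = l := by
    refine hperm.eq_of_pairwise (le := fun x y => r x ≤ r y) ?_ ?_ (hr.imp fun h => h.le)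
    · intro x y hx hy h1 h2
      exact hinj x (hperm.subset hx) y hy (le_antisymm h1 h2)
    · refine List.Pairwise.imp_of_mem ?_ hp
      intro x y hx hy h
      rwa [Nat.mod_eq_of_lt (hd' x hx), Nat.mod_eq_of_lt (hd' y hy)] at h
  exact this ▸ hm

/-- Any full configuration can be transformed into any other one. -/
theorem sort {e : ι} (τ : α → ι) (r : α → ℕ) (S : Finset ι) (hS2 : 2 ≤ S.card)
    (heS : e ∉ S) (s g : ι → List α) (he : s e = []) (hs : ∀ i ∈ S, (s i).length = d)
    (hg : ∀ i ∈ S, (g i).length = d) (hsg : ∀ i, i ∉ S → s i = g i)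
    (hsum : ∑ i ∈ S, (s i : Multiset α) = ∑ i ∈ S, (g i : Multiset α))
    (hτ : ∀ i ∈ S, ∀ x ∈ g i, τ x = i) (hd : ∀ i ∈ S, ∀ x ∈ g i, r x < d)
    (hr : ∀ i ∈ S, (g i).Pairwise (fun x y => r x < r y)) :
    Moves d s g (11 * d * (S.card * Nat.clog 2 S.card) + S.card * (4 * d * Nat.clog 2 d)) := by
  have hfilter (t : ι → List α) (ht : ∀ i ∈ S, ∀ x ∈ t i, τ x = i) (i : ι) (hi : i ∈ S) :
      Multiset.filter (τ · = i) (∑ i ∈ S, (t i : Multiset α)) = t i := by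
    rw [← Finset.add_sum_erase S _ hi, Multiset.filter_add,
      Multiset.filter_eq_self.2 (by simpa using ht i hi), Multiset.filter_eq_nil.2, add_zero]
    intro x hx h
    obtain ⟨j, hj, hx⟩ := Multiset.mem_sum.1 hx
    rw [ht j (Finset.mem_of_mem_erase hj) x (by simpa using hx)] at h
    exact Finset.ne_of_mem_erase hj h
  obtain ⟨s', hm, h1, h2, h3⟩ := sort_stacks (e := e) (d := d) τ (Nat.clog 2 S.card) S
    (Nat.le_pow_clog one_lt_two _) heS s he hs
    (fun i hi x hx => by
      have : x ∈ ∑ i ∈ S, (s i : Multiset α) := Multiset.mem_sum.2 ⟨i, hi, by simpa using hx⟩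
      rw [hsum, Multiset.mem_sum] at this
      obtain ⟨j, hj, hx⟩ := this
      rw [hτ j hj x (by simpa using hx)]
      exact hj)
    (fun i hi => by
      rw [hsum, Multiset.countP_eq_card_filter, hfilter g hτ i hi, Multiset.coe_card, hg i hi])
  have hperm : ∀ i ∈ S, (g i).Perm (s' i) := fun i hi => by
    rw [← Multiset.coe_eq_coe, ← hfilter g hτ i hi, ← hfilter s' (fun i hi => (h2 i hi).2) i hi,
      h3, hsum]
  have key : ∀ T ⊆ S, Moves d s' (fun i => if i ∈ T then g i else s' i)
      (T.card * (4 * d * Nat.clog 2 d)) := by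
    intro T
    induction T using Finset.induction_on with
    | empty => intro _; simpa using .refl _ _
    | insert a T ha ih =>
      intro hT
      have haS := hT (Finset.mem_insert_self a T)
      obtain ⟨b, hbS, hba⟩ := Finset.exists_mem_ne (by omega : 1 < S.card) a
      have hlen : ∀ i ∈ S, (if i ∈ T then g i else s' i).length = d := by
        intro i hi
        split_ifs
        · exact hg i hi
        · exact (h2 i hi).1
      have h := sort_stack (d := d) (e := e) hba.symm (fun h => heS (h ▸ haS))
        (fun h => heS (h ▸ hbS)) r (fun i => if i ∈ T then g i else s' i) (hlen a haS)
        (hlen b hbS)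
        (by
          have : e ∉ T := fun h => heS (hT (Finset.mem_insert_of_mem h))
          simp [this, h1 e heS, he])
        (g a) (by simpa [ha] using hperm a haS) (hr a haS) (hd a haS)
      have h' := (ih fun i hi => hT (Finset.mem_insert_of_mem hi)).trans h
      rw [Finset.card_insert_of_notMem ha, add_mul, one_mul]
      convert h' using 1
      funext i
      by_cases hi : i = a
      · subst hi; simp
      · simp [hi]
  have h := hm.trans (key S subset_rfl)
  convert h using 1
  funext i
  by_cases hi : i ∈ S
  · simp [hi]
  · simp [hi, h1 i hi, hsg i hi]

end Moves

end Stacks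

namespace Arrangement

open Function

variable {n k d : ℕ}

/-- The lists `s` (top first) are the contents of the stacks of `π`. -/
def HasContents (π : Arrangement n k d) (s : Fin k → List (Fin n)) : Prop :=
  (∀ i, (s i).length ≤ d) ∧
    ∀ o i j, π.pos o = (i, j) ↔ ∃ t, (o :: t) <:+ s i ∧ t.length + 1 + (j : ℕ) = d

theorem HasContents.unique {π π' : Arrangement n k d} {s : Fin k → List (Fin n)}
    (h : π.HasContents s) (h' : π'.HasContents s) : π = π' := by
  have : π.pos = π'.pos := funext fun o => ((h'.2 o _ _).2 ((h.2 o _ _).1 rfl)).symm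
  cases π; cases π'; congr

theorem hasContents_filterMap (π : Arrangement n k d) (f : Fin k × Fin d → Option (Fin n))
    (hf : ∀ o p, f p = some o ↔ π.pos o = p) :
    π.HasContents (fun i => (List.finRange d).filterMap fun j => f (i, j)) := by
  refine ⟨fun i => (List.length_filterMap_le _ _).trans (by simp), fun o i j => ?_⟩
  have key (x : Fin d) (l l' : List (Fin d)) (hl : List.finRange d = l ++ x :: l') (o : Fin n)
      (ho : f (i, x) = some o) :
      (l'.filterMap fun j => f (i, j)).length + 1 + (x : ℕ) = d := by
    have hlen := congrArg List.length hl
    have hx : (List.finRange d)[l.length]'(by rw [hl]; simp) = x := by simp [hl]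
    rw [List.getElem_finRange] at hx
    have hx' : (x : ℕ) = l.length := by rw [← hx]; simp
    have hsorted := List.pairwise_lt_finRange d
    rw [hl, List.pairwise_append, List.pairwise_cons] at hsorted
    have : (l'.filterMap fun j => f (i, j)).length = l'.length := by
      rw [List.filterMap_length_eq_length]
      intro y hy
      have hpos := (hf _ _).1 ho
      obtain ⟨o', ho'⟩ := π.contig o y (by rw [hpos]; exact (hsorted.2.1.1 y hy).le)
      rw [hpos] at ho'
      simp [(hf o' _).2 ho']
    simp at hlen
    omega
  rw [← hf]
  constructor
  · intro ho
    obtain ⟨l, l', hl⟩ := List.append_of_mem (List.mem_finRange j)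
    refine ⟨l'.filterMap fun j => f (i, j), ⟨l.filterMap fun j => f (i, j), ?_⟩, key j l l' hl o ho⟩
    simp [hl, ho]
  · rintro ⟨t, ⟨u, hu⟩, ht⟩
    obtain ⟨l₁, l₂, hl, -, h₂⟩ := List.filterMap_eq_append_iff.1 hu.symm
    obtain ⟨l₃, x, l₄, hl', -, hx, h₄⟩ := List.filterMap_eq_cons_iff.1 h₂
    have := key x (l₁ ++ l₃) l₄ (by rw [hl, hl', List.append_assoc]) o hx
    rw [h₄] at this
    have hxj : x = j := Fin.ext (by omega)
    exact hxj ▸ hx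

theorem _root_.List.exists_cons_suffix {α : Type*} (l : List α) (m : ℕ) (hm : m < l.length) :
    ∃ a t, (a :: t) <:+ l ∧ t.length = m := by
  refine ⟨l[l.length - 1 - m], l.drop (l.length - 1 - m + 1), ?_, ?_⟩
  · rw [← List.drop_eq_getElem_cons]
    exact List.drop_suffix _ _
  · simp; omega

theorem HasContents.exists_pos_eq {π : Arrangement n k d} {s : Fin k → List (Fin n)}
    (h : π.HasContents s) (i : Fin k) (j : Fin d) (hj : d ≤ (s i).length + j) :
    ∃ o, π.pos o = (i, j) := by
  obtain ⟨o, t, hot, ht⟩ := (s i).exists_cons_suffix (d - 1 - j) (by omega)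
  exact ⟨o, (h.2 o i j).2 ⟨t, hot, by omega⟩⟩

theorem HasContents.exists_step {π : Arrangement n k d} {s : Fin k → List (Fin n)}
    (h : π.HasContents s) {i j : Fin k} (hij : i ≠ j) {a : Fin n} {t : List (Fin n)}
    (hi : s i = a :: t) (hj : (s j).length < d) :
    ∃ π' : Arrangement n k d, Step π π' ∧
      π'.HasContents (update (update s i t) j (a :: s j)) := by
  have hlen := h.1 i
  rw [hi, List.length_cons] at hlen
  have ha : π.pos a = (i, ⟨d - 1 - t.length, by omega⟩) :=
    (h.2 a i _).2 ⟨t, by rw [hi], by simp; omega⟩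
  set y : Fin d := ⟨d - 1 - (s j).length, by omega⟩ with hy
  have hfree : ∀ o, π.pos o ≠ (j, y) := by
    intro o ho
    obtain ⟨u, hu, hu'⟩ := (h.2 o _ _).1 ho
    have := hu.length_le
    simp [hy] at this hu'
    omega
  have htop : ∀ o, o ≠ a → (π.pos o).1 = i → (π.pos a).2 < (π.pos o).2 := by
    intro o ho hoi
    obtain ⟨u, hu, hu'⟩ := (h.2 o (π.pos o).1 (π.pos o).2).1 rfl
    rw [hoi, hi, List.suffix_cons_iff] at hu
    rcases hu with hu | hu
    · simp [ho] at hu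
    · have := hu.length_le
      simp only [List.length_cons] at this
      rw [ha, Fin.lt_def]
      simp only
      omega
  let π' : Arrangement n k d :=
    { pos := update π.pos a (j, y)
      inj := by
        intro x z hxz
        by_cases hx : x = a <;> by_cases hz : z = a
        · rw [hx, hz]
        · subst hx; simp [hz] at hxz; exact absurd hxz.symm (hfree z)
        · subst hz; simp [hx] at hxz; exact absurd hxz (hfree x)
        · simp [hx, hz] at hxz; exact π.inj hxz
      contig := by
        intro o j' hj'
        by_cases ho : o = a
        · subst ho
          simp only [update_self] at hj' ⊢
          rcases hj'.eq_or_lt with rfl | hlt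
          · exact ⟨o, by simp⟩
          · obtain ⟨o', ho'⟩ := h.exists_pos_eq j j' (by
              rw [Fin.lt_def] at hlt
              simp [hy] at hlt
              omega)
            refine ⟨o', ?_⟩
            rw [update_of_ne, ho']
            rintro rfl
            rw [ha] at ho'
            exact hij (congrArg Prod.fst ho')
        · simp only [update_of_ne ho] at hj' ⊢
          obtain ⟨o', ho'⟩ := π.contig o j' hj'
          refine ⟨o', ?_⟩
          rw [update_of_ne, ho']
          rintro rfl
          have h1 := htop o ho (by rw [ha] at ho'; exact (congrArg Prod.fst ho').symm)
          rw [ho'] at h1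
          exact absurd hj' (not_le.2 h1) }
  refine ⟨π', ⟨a, ?_, ?_, ?_⟩, ?_, ?_⟩
  · simp [π', ha, hij.symm]
  · intro o ho hoa
    exact htop o ho (by rw [hoa, ha])
  · intro o ho
    simp [π', ho]
  · intro x
    have := h.1 x
    by_cases hxj : x = j
    · subst hxj; simp; omega
    · by_cases hxi : x = i
      · subst hxi; simp [hxj]; omega
      · simp [hxi, hxj, this]
  · intro o x z
    by_cases ho : o = a
    · subst ho
      simp only [π', update_self]
      constructor
      · intro hxz
        rw [Prod.mk.injEq] at hxz
        obtain ⟨rfl, rfl⟩ := hxz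
        exact ⟨s j, by simp, by simp [hy]; omega⟩
      · rintro ⟨u, hu, hu'⟩
        by_cases hxj : x = j
        · subst hxj
          rw [update_self, List.suffix_cons_iff] at hu
          rcases hu with hu | hu
          · simp only [List.cons.injEq, true_and] at hu
            rw [Prod.mk.injEq]
            refine ⟨rfl, Fin.ext ?_⟩
            simp only [hy]
            rw [← hu]
            omega
          · have := (h.2 o x z).2 ⟨u, hu, hu'⟩
            rw [ha] at this
            exact absurd (congrArg Prod.fst this) hij
        · rw [update_of_ne hxj] at hu
          by_cases hxi : x = i
          · subst hxi
            rw [update_self] at hu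
            have h1 := (h.2 o x z).2 ⟨u, hi ▸ hu.trans (List.suffix_cons _ _), hu'⟩
            have h2 := congrArg (fun p => (p.2 : ℕ)) (ha.symm.trans h1)
            have := hu.length_le
            simp at h2 this
            omega
          · rw [update_of_ne hxi] at hu
            have := (h.2 o x z).2 ⟨u, hu, hu'⟩
            rw [ha] at this
            exact absurd (congrArg Prod.fst this).symm hxi
    · simp only [π', update_of_ne ho]
      rw [h.2 o x z]
      refine exists_congr fun u => and_congr_left fun _ => ?_
      by_cases hxj : x = j
      · subst hxj
        simp [List.suffix_cons_iff, ho]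
      · by_cases hxi : x = i
        · subst hxi
          simp [hxj, hi, List.suffix_cons_iff, ho]
        · simp [hxi, hxj]

end Arrangement

section Reach

open Function

variable {n k d : ℕ}

theorem Step.symm {π π' : Arrangement n k d} (h : Step π π') : Step π' π := by
  obtain ⟨o, h1, h2, h3⟩ := h
  refine ⟨o, h1.symm, fun o' ho' hst => ?_, fun o' ho' => (h3 o' ho').symm⟩
  by_contra hlt
  rw [not_lt] at hlt
  rw [h3 o' ho'] at hst hlt
  obtain ⟨x, hx⟩ := π.contig o' _ hlt
  rw [hst, Prod.mk.eta] at hx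
  have hxo : x ≠ o := by
    rintro rfl
    exact h1 (congrArg Prod.fst hx).symm
  rw [← h3 x hxo] at hx
  exact hxo (π'.inj hx)

theorem Reach.refl (π : Arrangement n k d) : Reach π π 0 :=
  ⟨fun _ => π, rfl, rfl, by simp⟩

theorem Reach.head {π₁ π₂ π₃ : Arrangement n k d} {m : ℕ} (h : Step π₁ π₂)
    (h' : Reach π₂ π₃ m) : Reach π₁ π₃ (m + 1) := by
  obtain ⟨f, rfl, hm, hf⟩ := h'
  refine ⟨fun t => Nat.casesOn t π₁ f, rfl, hm, fun t ht => ?_⟩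
  cases t with
  | zero => exact h
  | succ t => exact hf t (by omega)

theorem Reach.trans {π₁ π₂ π₃ : Arrangement n k d} {m m' : ℕ} (h : Reach π₁ π₂ m)
    (h' : Reach π₂ π₃ m') : Reach π₁ π₃ (m + m') := by
  induction m generalizing π₁ with
  | zero =>
    obtain ⟨f, rfl, rfl, -⟩ := h
    rwa [zero_add]
  | succ m ih =>
    obtain ⟨f, rfl, hm, hf⟩ := h
    rw [Nat.add_right_comm]
    exact .head (hf 0 (by omega)) (ih ⟨fun t => f (t + 1), rfl, hm, fun t ht => hf _ (by omega)⟩)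

theorem Reach.symm {π π' : Arrangement n k d} {m : ℕ} (h : Reach π π' m) : Reach π' π m := by
  obtain ⟨f, rfl, rfl, hf⟩ := h
  refine ⟨fun t => f (m - t), by simp, by simp, fun t ht => ?_⟩
  have := (hf (m - (t + 1)) (by omega)).symm
  rwa [show m - (t + 1) + 1 = m - t by omega] at this

/-- Moves of labelled cells, some of which carry an object, induce moves of the objects. -/
theorem Moves.exists_reach {β : Type*} (f : β → Option (Fin n)) {s s' : Fin k → List β} {m : ℕ}
    (hm : Moves d s s' m) {π : Arrangement n k d}
    (h : π.HasContents fun i => (s i).filterMap f) :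
    ∃ π' m', m' ≤ m ∧ Reach π π' m' ∧ π'.HasContents fun i => (s' i).filterMap f := by
  induction hm generalizing π with
  | refl s m => exact ⟨π, 0, by omega, .refl π, h⟩
  | @step s s' m i j a t hij hi hj _ ih =>
    cases ha : f a with
    | none =>
      obtain ⟨π', m', hm', hr, hc⟩ := ih (π := π) (by
        convert h using 2 with x
        by_cases hxj : x = j
        · subst hxj; simp [ha]
        · by_cases hxi : x = i
          · subst hxi; simp [hxj, hi, ha]
          · simp [hxi, hxj])
      exact ⟨π', m', by omega, hr, hc⟩
    | some o =>
      obtain ⟨π₁, hst, hc₁⟩ := h.exists_step hij (a := o) (t := t.filterMap f)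
        (by simp [hi, ha]) ((List.length_filterMap_le _ _).trans_lt hj)
      obtain ⟨π', m', hm', hr, hc⟩ := ih (π := π₁) (by
        convert hc₁ using 2 with x
        by_cases hxj : x = j
        · subst hxj; simp [ha]
        · by_cases hxi : x = i
          · subst hxi; simp [hxj]
          · simp [hxi, hxj])
      exact ⟨π', m' + 1, by omega, .head hst hr, hc⟩

theorem Arrangement.HasContents.exists_reach_last_empty {w : ℕ} (hn : n ≤ w * d)
    (l : List (Fin n)) {π : Arrangement n (w + 1) d} {s : Fin (w + 1) → List (Fin n)}
    (h : π.HasContents s) (hl : s (Fin.last w) = l) :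
    ∃ π' m, m ≤ l.length ∧ Reach π π' m ∧ ∀ o, (π'.pos o).1 ≠ Fin.last w := by
  induction l generalizing π s with
  | nil =>
    refine ⟨π, 0, le_rfl, .refl π, fun o ho => ?_⟩
    obtain ⟨t, ht, -⟩ := (h.2 o _ _).1 rfl
    rw [ho, hl] at ht
    simp at ht
  | cons a t ih =>
    obtain ⟨i, hi, hlen⟩ : ∃ i, Fin.last w ≠ i ∧ (s i).length < d := by
      by_contra! hcon
      have hφ : ∀ p : Fin w × Fin d, ∃ o, π.pos o = (p.1.castSucc, p.2) := fun p =>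
        h.exists_pos_eq _ _ ((hcon _ (Fin.castSucc_lt_last p.1).ne').trans (Nat.le_add_right _ _))
      choose φ hφ using hφ
      have hlen := h.1 (Fin.last w)
      rw [hl, List.length_cons] at hlen
      have ha : π.pos a = (Fin.last w, ⟨d - 1 - t.length, by omega⟩) :=
        (h.2 a _ _).2 ⟨t, by rw [hl], by simp; omega⟩
      have hinj : Injective (fun p : Option (Fin w × Fin d) => p.elim a φ) := by
        intro p q hpq
        have := congrArg π.pos hpq
        rcases p with _ | p <;> rcases q with _ | q
        · rfl
        · simp [ha, hφ, (Fin.castSucc_lt_last q.1).ne'] at this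
        · simp [ha, hφ, (Fin.castSucc_lt_last p.1).ne] at this
        · simpa [hφ, Prod.ext_iff] using this
      have := Fintype.card_le_of_injective _ hinj
      simp at this
      omega
    obtain ⟨π₁, hst, hc₁⟩ := h.exists_step hi hl hlen
    obtain ⟨π', m, hm, hr, hlast⟩ := ih hc₁ (by simp [hi])
    exact ⟨π', m + 1, by simpa using hm, .head hst hr, hlast⟩

theorem Arrangement.exists_reach_last_empty {w : ℕ} (hn : n ≤ w * d)
    (π : Arrangement n (w + 1) d) :
    ∃ π' m, m ≤ d ∧ Reach π π' m ∧ ∀ o, (π'.pos o).1 ≠ Fin.last w := by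
  have h := π.hasContents_filterMap (partialInv π.pos) fun o p => π.inj.isPartialInv o p
  obtain ⟨π', m, hm, hr, hlast⟩ := h.exists_reach_last_empty hn _ rfl
  exact ⟨π', m, hm.trans (h.1 _), hr, hlast⟩

theorem exists_perm_comp_eq {α β : Type*} [Finite β] (f g : α → β) (hf : Injective f)
    (hg : Injective g) : ∃ σ : Equiv.Perm β, ∀ a, σ (f a) = g a := by
  classical
  have := Fintype.ofFinite β
  let e := (Equiv.ofInjective f hf).symm.trans (Equiv.ofInjective g hg)
  refine ⟨Equiv.extendSubtype (p := (· ∈ Set.range f)) (q := (· ∈ Set.range g)) e, fun a => ?_⟩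
  rw [Equiv.extendSubtype_apply_of_mem (p := (· ∈ Set.range f)) (q := (· ∈ Set.range g)) e _
    ⟨a, rfl⟩]
  change (Equiv.ofInjective g hg
    ((Equiv.ofInjective f hf).symm (Equiv.ofInjective f hf a)) : β) = g a
  rw [Equiv.symm_apply_apply, Equiv.ofInjective_apply]

theorem sum_coe_map_finRange {α : Type*} (w d : ℕ) (f : Fin w × Fin d → α) :
    ∑ c : Fin w, (((List.finRange d).map fun j => f (c, j) : List α) : Multiset α) =
      ∑ p : Fin w × Fin d, {f p} := by
  rw [Fintype.sum_prod_type]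
  refine Finset.sum_congr rfl fun c _ => ?_
  rw [← List.ofFn_eq_map, ← Fin.univ_val_map, Finset.sum,
    ← Multiset.sum_map_singleton (Multiset.map _ _), Multiset.map_map]
  rfl

theorem Arrangement.exists_reach_of_last_empty {w : ℕ} (hw : 2 ≤ w)
    (π π' : Arrangement n (w + 1) d) (hπ : ∀ o, (π.pos o).1 ≠ Fin.last w)
    (hπ' : ∀ o, (π'.pos o).1 ≠ Fin.last w) :
    ∃ m, m ≤ 11 * d * (w * Nat.clog 2 w) + w * (4 * d * Nat.clog 2 d) ∧ Reach π π' m := by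
  let cell (π : Arrangement n (w + 1) d) (hπ : ∀ o, (π.pos o).1 ≠ Fin.last w) (o : Fin n) :
    Fin w × Fin d := ((π.pos o).1.castPred (hπ o), (π.pos o).2)
  have hcell (π : Arrangement n (w + 1) d) (hπ) (o c j) :
      cell π hπ o = (c, j) ↔ π.pos o = (c.castSucc, j) := by
    rw [Prod.ext_iff, Prod.ext_iff, ← Fin.castSucc_inj]
    simp [cell]
  have hinj (π : Arrangement n (w + 1) d) (hπ) : Injective (cell π hπ) := by
    intro o o' h
    have := (hcell π hπ o _ _).1 h
    exact π.inj (this.trans ((hcell π hπ o' _ _).1 rfl).symm)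
  obtain ⟨σ, hσ⟩ := exists_perm_comp_eq (cell π hπ) (cell π' hπ') (hinj π hπ) (hinj π' hπ')
  let layout (ρ : Equiv.Perm (Fin w × Fin d)) : Fin (w + 1) → List (Fin w × Fin d) :=
    Fin.lastCases [] fun c => (List.finRange d).map fun j => ρ (c, j)
  let f := partialInv (cell π' hπ')
  have hf : ∀ o p, f p = some o ↔ cell π' hπ' o = p := fun o p =>
    (hinj π' hπ').isPartialInv o p
  have hcontents (π₁ : Arrangement n (w + 1) d) (hπ₁) (ρ : Equiv.Perm (Fin w × Fin d))
      (hρ : ∀ o, ρ (cell π₁ hπ₁ o) = cell π' hπ' o) :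
      π₁.HasContents fun i => (layout ρ i).filterMap f := by
    have hf₁ : ∀ o p, partialInv π₁.pos p = some o ↔ π₁.pos o = p :=
      fun o p => π₁.inj.isPartialInv o p
    convert π₁.hasContents_filterMap _ hf₁ using 2 with i
    induction i using Fin.lastCases with
    | last =>
      simp only [layout, Fin.lastCases_last, List.filterMap_nil]
      symm
      rw [List.filterMap_eq_nil_iff]
      intro j _
      rw [Option.eq_none_iff_forall_ne_some]
      intro o ho
      rw [hf₁] at ho
      exact hπ₁ o (by rw [ho])
    | cast c =>
      simp only [layout, Fin.lastCases_castSucc, List.filterMap_map]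
      congr 1
      funext j
      ext o
      rw [hf₁, ← hcell π₁ hπ₁, comp_apply, hf, ← hρ, ρ.injective.eq_iff]
  have hS : (Finset.univ.map (Fin.castSuccEmb (n := w))).card = w := by simp
  have hm := Moves.sort (d := d) (e := Fin.last w) (fun x : Fin w × Fin d => x.1.castSucc)
    (fun x => (x.2 : ℕ)) (Finset.univ.map Fin.castSuccEmb) (by rw [hS]; exact hw)
    (by simp [Fin.castSucc_ne_last]) (layout σ) (layout 1) (by simp [layout]) (by simp [layout])
    (by simp [layout])
    (by
      intro i hi
      induction i using Fin.lastCases with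
      | last => simp [layout]
      | cast c => simp at hi)
    (by
      simp only [Finset.sum_map, Fin.castSuccEmb_apply, layout, Fin.lastCases_castSucc]
      rw [sum_coe_map_finRange, sum_coe_map_finRange]
      exact (Equiv.sum_comp σ fun p => ({p} : Multiset (Fin w × Fin d))))
    (by simp [layout]) (by simp [layout])
    (by
      simp only [Finset.mem_map, Finset.mem_univ, true_and, Fin.castSuccEmb_apply,
        forall_exists_index, forall_apply_eq_imp_iff, layout, Fin.lastCases_castSucc,
        List.pairwise_map, Equiv.Perm.coe_one, id_eq]
      exact fun _ => List.pairwise_lt_finRange d)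
  rw [hS] at hm
  obtain ⟨π₁, m, hle, hr, hc⟩ := hm.exists_reach f (hcontents π hπ σ hσ)
  exact ⟨m, hle, hc.unique (hcontents π' hπ' 1 fun _ => rfl) ▸ hr⟩

theorem clog_two_le (x : ℕ) : (Nat.clog 2 x : ℝ) ≤ 1 + 2 * Real.log x := by
  rw [← Real.natCeil_logb_natCast]
  have hlog : 0 ≤ Real.log x := Real.log_natCast_nonneg x
  have h2 := Real.log_two_gt_d9
  have h : Real.logb 2 x ≤ 2 * Real.log x := by
    rw [Real.logb, div_le_iff₀ (by linarith)]
    nlinarith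
  have h0 : 0 ≤ Real.logb 2 x := div_nonneg hlog (by linarith)
  have := Nat.ceil_lt_add_one h0
  push_cast
  linarith

end Reach

/-- There is a universal constant `c > 0` such that for all `w ≥ 2`, `d ≥ 1`,
every LSR instance with `n ≤ w*d` objects in `w+1` stacks of capacity `d` has a solution
of at most `c·w·d·(1 + max(log d, log w))` permissible pop-and-push actions. -/
theorem lsr_general_upper_bound :
    ∃ c : ℝ, 0 < c ∧ ∀ w d n : ℕ, 2 ≤ w → 1 ≤ d → n ≤ w * d →
      ∀ πI πG : Arrangement n (w + 1) d,
        ∃ m : ℕ, (m : ℝ) ≤ c * w * d * (1 + max (Real.log d) (Real.log w)) ∧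
          Reach πI πG m := by
  refine ⟨32, by norm_num, fun w d n hw hd hn πI πG => ?_⟩
  obtain ⟨π₁, m₁, hm₁, hr₁, h₁⟩ := πI.exists_reach_last_empty hn
  obtain ⟨π₂, m₂, hm₂, hr₂, h₂⟩ := πG.exists_reach_last_empty hn
  obtain ⟨m, hm, hr⟩ := π₁.exists_reach_of_last_empty hw π₂ h₁ h₂
  refine ⟨m₁ + m + m₂, ?_, (hr₁.trans hr).trans hr₂.symm⟩
  set M := max (Real.log d) (Real.log w)
  have hMd : (Nat.clog 2 d : ℝ) ≤ 1 + 2 * M :=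
    (clog_two_le d).trans (by linarith [le_max_left (Real.log d) (Real.log w)])
  have hMw : (Nat.clog 2 w : ℝ) ≤ 1 + 2 * M :=
    (clog_two_le w).trans (by linarith [le_max_right (Real.log d) (Real.log w)])
  have hM : 0 ≤ M := (Real.log_natCast_nonneg d).trans (le_max_left _ _)
  have hwR : (2 : ℝ) ≤ w := by exact_mod_cast hw
  have hdR : (1 : ℝ) ≤ d := by exact_mod_cast hd
  have hm₁R : (m₁ : ℝ) ≤ d := by exact_mod_cast hm₁
  have hm₂R : (m₂ : ℝ) ≤ d := by exact_mod_cast hm₂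
  have hmR : (m : ℝ) ≤ 11 * d * (w * Nat.clog 2 w) + w * (4 * d * Nat.clog 2 d) := by
    exact_mod_cast hm
  have hwd : (0 : ℝ) ≤ w * d := by positivity
  have h1 := mul_le_mul_of_nonneg_left hMw hwd
  have h2 := mul_le_mul_of_nonneg_left hMd hwd
  have h3 := mul_nonneg hwd hM
  have h4 : (d : ℝ) * 2 ≤ w * d := by nlinarith
  push_cast
  nlinarith
end
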